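/- Let C : f = 0 be a reduced plane curve of degree d ≥ 3 in P²(ℂ), not the union of d lines through one point, and let r = mdr(f). Then (d−1)(d−r−1) ≤ τ(C) ≤ (d−1)² − r(d−r−1). Moreover, if 2r ≥ d, then the stronger upper bound τ(C) ≤ (d−1)² − r(d−r−1) − binom(2r+2−d, 2) holds. -/

import Mathlib

open MvPolynomial

noncomputable section

/-- `S = ℂ[x,y,z]`, with `x = X 0`, `y = X 1`, `z = X 2`. -/
abbrev S3 := MvPolynomial (Fin 3) ℂ

/-- The graded `S`-module `D_0(f)` of Jacobian syzygies of `f`. -/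
def jacSyz (f : S3) : Submodule S3 (Fin 3 → S3) where
  carrier := {v | v 0 * pderiv 0 f + v 1 * pderiv 1 f + v 2 * pderiv 2 f = 0}
  add_mem' := by
    intro a b ha hb
    simp only [Set.mem_setOf_eq, Pi.add_apply] at *
    linear_combination ha + hb
  zero_mem' := by simp
  smul_mem' := by
    intro c v hv
    simp only [Set.mem_setOf_eq, Pi.smul_apply, smul_eq_mul] at *
    linear_combination c * hv

/-- `v` is a minimal system of `m` homogeneous generators of `D_0(f)`, the generator
`v j` being a syzygy of degree `dd j`, and `dd` nondecreasing: this says that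
`C : f = 0` is an `m`-syzygy curve with exponents `dd`. -/
structure IsMinGenSyz (f : S3) (m : ℕ) (dd : Fin m → ℕ) (v : Fin m → (Fin 3 → S3)) : Prop where
  mem : ∀ j, v j ∈ jacSyz f
  hom : ∀ j i, ((v j) i).IsHomogeneous (dd j)
  ne_zero : ∀ j, v j ≠ 0
  span_eq : Submodule.span S3 (Set.range v) = jacSyz f
  minimal : ∀ j, v j ∉ Submodule.span S3 (v '' {j' | j' ≠ j})
  mono : Monotone dd

/-- `C : f = 0` is free with exponents `(d1, d2)`. -/
def IsFreeWith (f : S3) (d1 d2 : ℕ) : Prop := ∃ v, IsMinGenSyz f 2 ![d1, d2] v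

/-- `C : f = 0` is a free curve (a 2-syzygy curve). -/
def IsFreeCurve (f : S3) : Prop := ∃ d1 d2, IsFreeWith f d1 d2

/-- `C : f = 0` of degree `d` is nearly free with exponents `(d1, d2)`:
a 3-syzygy curve with exponents `(d1, d2, d2)` and `d1 + d2 = d`. -/
def IsNearlyFreeWith (f : S3) (d d1 d2 : ℕ) : Prop :=
  d1 + d2 = d ∧ ∃ v, IsMinGenSyz f 3 ![d1, d2, d2] v

/-- `C : f = 0` of degree `d` is a nearly free curve. -/
def IsNearlyFree (f : S3) (d : ℕ) : Prop := ∃ d1 d2, IsNearlyFreeWith f d d1 d2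

/-- `C : f = 0` of degree `d` is plus-one generated with exponents `(d1, d2, d3)`:
a 3-syzygy curve with `d1 + d2 = d`. -/
def IsPOGWith (f : S3) (d d1 d2 d3 : ℕ) : Prop :=
  d1 + d2 = d ∧ ∃ v, IsMinGenSyz f 3 ![d1, d2, d3] v

/-- `C : f = 0` of degree `d` is a plus-one generated curve. -/
def IsPOG (f : S3) (d : ℕ) : Prop := ∃ d1 d2 d3, IsPOGWith f d d1 d2 d3

/-- `C : f = 0` of degree `d` is minimal plus-one generated (MPOG),
with exponents `(d1, d2, d2 + 1)`. -/
def IsMPOGWith (f : S3) (d d1 d2 : ℕ) : Prop := IsPOGWith f d d1 d2 (d2 + 1)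

/-- `C : f = 0` of degree `d` is an MPOG-curve. -/
def IsMPOG (f : S3) (d : ℕ) : Prop := ∃ d1 d2, IsMPOGWith f d d1 d2

/-- `r = mdr(f)`: the minimal degree of a nonzero (homogeneous) Jacobian relation for `f`. -/
def IsMDR (f : S3) (r : ℕ) : Prop :=
  (∃ v ∈ jacSyz f, v ≠ 0 ∧ ∀ i, (v i).IsHomogeneous r) ∧
  ∀ m, m < r → ∀ v ∈ jacSyz f, (∀ i, (v i).IsHomogeneous m) → v = 0

/-- The Jacobian ideal `J_f` of `f`. -/
def jacobianIdeal (f : S3) : Ideal S3 := Ideal.span {pderiv 0 f, pderiv 1 f, pderiv 2 f}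

/-- The dimension of the degree `k` graded piece of the Milnor algebra `M(f) = S/J_f`. -/
def milnorDim (f : S3) (k : ℕ) : ℕ :=
  Module.finrank ℂ
    (↥(homogeneousSubmodule (Fin 3) ℂ k) ⧸
      (Submodule.comap (homogeneousSubmodule (Fin 3) ℂ k).subtype
        (Submodule.restrictScalars ℂ (jacobianIdeal f))))

/-- `τ` is the total Tjurina number of the reduced curve `C : f = 0`, i.e. the degree of the
Jacobian ideal `J_f`: for all large `k` one has `dim M(f)_k = τ`. -/
def IsTjurina (f : S3) (τ : ℕ) : Prop := ∀ᶠ k in Filter.atTop, milnorDim f k = τ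

/-- `C : f = 0` is a maximal Tjurina curve of type `(d, r)`. -/
def IsMaxTjurina (f : S3) (d r : ℕ) : Prop :=
  IsMDR f r ∧ d ≤ 2 * r ∧
  ∃ τ : ℕ, IsTjurina f τ ∧
    (τ : ℤ) = ((d : ℤ) - 1) ^ 2 - r * ((d : ℤ) - r - 1) - (Nat.choose (2 * r + 2 - d) 2 : ℤ)

/-- `f` is a product of `d` linear forms all vanishing at a common point, i.e.
`C : f = 0` is the union of `d` lines passing through one point. -/
def IsUnionOfConcurrentLines (f : S3) (d : ℕ) : Prop :=
  ∃ (c : ℂ) (L : Fin d → Fin 3 → ℂ) (v : Fin 3 → ℂ), v ≠ 0 ∧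
    f = C c * ∏ j, (∑ i, C (L j i) * X i) ∧ ∀ j, (∑ i, L j i * v i) = 0

/-- The ideal `I_θ` generated by the 2×2 minors of the matrix with rows `(x,y,z)` and
`(a,b,c)`, defining the eigenscheme `Γ_θ` of the derivation `θ = a ∂_x + b ∂_y + c ∂_z`. -/
def eigenIdeal (a b c : S3) : Ideal S3 :=
  Ideal.span {X 1 * c - X 2 * b, X 2 * a - X 0 * c, X 0 * b - X 1 * a}

/-- The projective plane `ℙ²(ℂ)`. -/
abbrev Pt := Projectivization ℂ (Fin 3 → ℂ)

/-- The eigenscheme `Γ_θ` of `θ = a ∂_x + b ∂_y + c ∂_z` is 0-dimensional: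
its set of points in `ℙ²` is finite. -/
def EigenSchemeFinite (a b c : S3) : Prop :=
  {p : Pt | eval p.rep (X 1 * c - X 2 * b) = 0 ∧ eval p.rep (X 2 * a - X 0 * c) = 0 ∧
      eval p.rep (X 0 * b - X 1 * a) = 0}.Finite

theorem homogeneousComponent_mul_of_isHomogeneous {R σ : Type*} [CommSemiring R] {m n : ℕ}
    (p : MvPolynomial σ R) {q : MvPolynomial σ R} (hq : q.IsHomogeneous n) :
    homogeneousComponent (m + n) (p * q) = homogeneousComponent m p * q := by
  let := gradedAlgebra (σ := σ) (R := R)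
  rw [← decomposition.decompose'_apply, ← decomposition.decompose'_apply]
  exact DirectSum.coe_decompose_mul_add_of_right_mem (homogeneousSubmodule σ R) hq

theorem finrank_homogeneousSubmodule_fin_three (k : ℕ) :
    Module.finrank ℂ (homogeneousSubmodule (Fin 3) ℂ k) = (k + 2).choose 2 := by
  have h := Finset.card_finsuppAntidiag_nat_eq_choose (s := (Finset.univ : Finset (Fin 3))) k
  have e : {d : Fin 3 →₀ ℕ | d.degree = k} =
      ((Finset.univ : Finset (Fin 3)).finsuppAntidiag k : Set (Fin 3 →₀ ℕ)) := by
    ext d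
    simp [Finset.mem_finsuppAntidiag, Finsupp.degree_eq_sum]
  rw [homogeneousSubmodule_eq_finsupp_supported, e,
    (AddMonoidAlgebra.supportedEquivFinsupp (R := ℂ) (S := ℂ) _).finrank_eq,
    Module.finrank_finsupp_self, ← Nat.card_eq_fintype_card, Nat.card_coe_set_eq,
    Set.ncard_coe_finset, h,
    add_comm k 2, Nat.choose_symm_add]
  simp

theorem dvd_of_forall_dvd_mul {R ι : Type*} [CommRing R] [IsDomain R]
    [UniqueFactorizationMonoid R] {a : ι → R} (ha : a ≠ 0)
    (hprim : ∀ p, Prime p → ¬ ∀ i, p ∣ a i) (x : R) :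
    ∀ y : R, (∀ i, x ∣ a i * y) → x ∣ y := by
  induction x using UniqueFactorizationMonoid.induction_on_prime with
  | h₁ =>
    intro y h
    obtain ⟨i, hi⟩ := Function.ne_iff.mp ha
    have := zero_dvd_iff.mp (h i)
    rcases mul_eq_zero.mp this with h0 | h0
    · exact absurd h0 hi
    · rw [h0]
  | h₂ x hx => exact fun y _ => hx.dvd
  | h₃ x p hx hp ih =>
    intro y h
    obtain ⟨i, hi⟩ := not_forall.mp (hprim p hp)
    obtain ⟨z, rfl⟩ := (hp.dvd_or_dvd ((dvd_mul_right p x).trans (h i))).resolve_left hi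
    refine mul_dvd_mul_left p (ih z fun j => ?_)
    have := h j
    rw [mul_left_comm] at this
    exact (mul_dvd_mul_iff_left hp.ne_zero).mp this

theorem exists_eq_mul_of_cross_eq {R ι : Type*} [CommRing R] [IsDomain R]
    [UniqueFactorizationMonoid R] {a b : ι → R} (ha : a ≠ 0)
    (hprim : ∀ p, Prime p → ¬ ∀ i, p ∣ a i) (h : ∀ i j, a i * b j = a j * b i) :
    ∃ c, ∀ i, b i = c * a i := by
  obtain ⟨i, hi⟩ := Function.ne_iff.mp ha
  obtain ⟨c, hc⟩ : a i ∣ b i :=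
    dvd_of_forall_dvd_mul ha hprim _ _ fun j => ⟨b j, (h i j).symm⟩
  refine ⟨c, fun j => mul_left_cancel₀ hi ?_⟩
  rw [h i j, hc]
  ring

theorem isUnit_of_forall_dvd_pderiv {σ : Type*} {p : MvPolynomial σ ℂ} (hp : p ≠ 0)
    (h : ∀ i, p ∣ pderiv i p) : IsUnit p := by
  have hz : ∀ i, pderiv i p = 0 := by
    intro i
    by_contra hne
    obtain ⟨t, ht⟩ := h i
    have ht0 : t ≠ 0 := by rintro rfl; exact hne (by simpa using ht)
    have h1 : p.totalDegree ≤ (pderiv i p).totalDegree := by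
      rw [ht, totalDegree_mul_of_isDomain hp ht0]
      exact Nat.le_add_right _ _
    obtain ⟨m, hm, hdeg⟩ := Finset.exists_mem_eq_sup (pderiv i p).support
      (support_nonempty.mpr hne) (fun s => s.sum fun _ e => e)
    have h2 : (pderiv i p).totalDegree = m.sum fun _ e => e := hdeg
    have h3 : m + Finsupp.single i 1 ∈ p.support := by
      rw [mem_support_iff] at hm ⊢
      rw [coeff_pderiv] at hm
      exact left_ne_zero_of_mul hm
    have h4 := le_totalDegree h3
    rw [Finsupp.sum_add_index' (fun _ => rfl) (fun _ _ _ => rfl),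
      Finsupp.sum_single_index rfl] at h4
    omega
  have hC : p = C (p.coeff 0) := by
    classical
    ext m
    rw [coeff_C]
    split_ifs with hm
    · rw [← hm]
    obtain ⟨i, hi⟩ := Finsupp.ne_iff.mp (Ne.symm hm)
    have h1 : coeff (m - Finsupp.single i 1) (pderiv i p) = 0 := by rw [hz i, coeff_zero]
    rw [coeff_pderiv, tsub_add_cancel_of_le
      (Finsupp.single_le_iff.mpr (Nat.one_le_iff_ne_zero.mpr hi))] at h1
    exact (mul_eq_zero.mp h1).resolve_right (Nat.cast_add_one_ne_zero _)
  have h0 : p.coeff 0 ≠ 0 := fun h0 => hp (by rw [hC, h0, C_0])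
  rw [hC]
  exact (isUnit_iff_ne_zero.mpr h0).map C

theorem not_forall_dvd_pderiv {f : S3} {d : ℕ} (hd : d ≠ 0) (hhom : f.IsHomogeneous d)
    (hred : Squarefree f) (p : S3) (hp : Prime p) : ¬ ∀ i, p ∣ pderiv i f := by
  intro h
  have hf : p ∣ f := by
    have h1 : p ∣ d • f := by
      rw [← hhom.sum_X_mul_pderiv]
      exact Finset.dvd_sum fun i _ => Dvd.dvd.mul_left (h i) _
    rw [nsmul_eq_mul, ← map_natCast (C : ℂ →+* S3)] at h1
    refine (IsUnit.dvd_mul_left ?_).mp h1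
    exact (isUnit_iff_ne_zero.mpr (Nat.cast_ne_zero.mpr hd)).map C
  obtain ⟨q, rfl⟩ := hf
  have hq : ¬ p ∣ q := fun hpq => hp.not_isUnit (hred p (mul_dvd_mul_left p hpq))
  refine hp.not_isUnit (isUnit_of_forall_dvd_pderiv hp.ne_zero fun i => ?_)
  have h1 := h i
  rw [Derivation.leibniz, smul_eq_mul, smul_eq_mul, dvd_add_right (dvd_mul_right p _)] at h1
  exact (hp.dvd_or_dvd h1).resolve_left hq

theorem exists_coprime_combinations {K R : Type*} [Field K] [Infinite K] [CommRing R] [IsDomain R]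
    [UniqueFactorizationMonoid R] [Algebra K R] (a : Fin 3 → R)
    (hprim : ∀ p, Prime p → ¬ ∀ i, p ∣ a i) (ha : a ≠ 0) :
    ∃ s t : Fin 3 → K, ∑ i, s i • a i ≠ 0 ∧
      ∀ p, Prime p → p ∣ ∑ i, s i • a i → ¬ p ∣ ∑ i, t i • a i := by
  classical
  obtain ⟨i₀, hi₀⟩ := Function.ne_iff.mp ha
  obtain ⟨i₁, i₂, hi⟩ : ∃ i₁ i₂ : Fin 3, ∀ i, i = i₀ ∨ i = i₁ ∨ i = i₂ := by
    clear hi₀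
    revert i₀
    decide
  refine ⟨Pi.single i₀ 1, ?_⟩
  have hs : ∑ i, (Pi.single i₀ 1 : Fin 3 → K) i • a i = a i₀ := by
    simp [Pi.single_apply]
  rw [hs]
  by_contra! hcon
  have hcon' : ∀ c : K, ∃ q : {q // q ∈ (UniqueFactorizationMonoid.factors (a i₀)).toFinset},
      (q : R) ∣ a i₁ + c • a i₂ := by
    intro c
    obtain ⟨p, hp, hp₀, hpc⟩ := hcon (Pi.single i₁ 1 + c • Pi.single i₂ 1) hi₀
    obtain ⟨q, hq, hpq⟩ := UniqueFactorizationMonoid.exists_mem_factors_of_dvd hi₀ hp.irreducible hp₀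
    refine ⟨⟨q, Multiset.mem_toFinset.mpr hq⟩, hpq.symm.dvd.trans ?_⟩
    convert hpc using 1
    simp [add_smul, Finset.sum_add_distrib, Pi.single_apply]
  choose q hq using hcon'
  obtain ⟨c, c', hne, hcc⟩ := Finite.exists_ne_map_eq_of_infinite q
  have hqm := Multiset.mem_toFinset.mp (q c).2
  have h1 := hq c
  have h2 := hq c'
  rw [← hcc] at h2
  have h3 : (q c : R) ∣ a i₂ := by
    have := dvd_sub h1 h2
    rw [add_sub_add_left_eq_sub, ← sub_smul] at this
    have h4 := this.trans (Dvd.intro_left (algebraMap K R (c - c')⁻¹) rfl)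
    rwa [← Algebra.smul_def, inv_smul_smul₀ (sub_ne_zero.mpr hne)] at h4
  refine hprim _ (UniqueFactorizationMonoid.prime_of_factor _ hqm) fun i => ?_
  rcases hi i with rfl | rfl | rfl
  · exact UniqueFactorizationMonoid.dvd_of_mem_factors hqm
  · refine (dvd_add_left ?_).mp h1
    exact h3.trans (by rw [Algebra.smul_def]; exact dvd_mul_left _ _)
  · exact h3

theorem mem_span_X_of_mul_X_mem {R : Type*} [CommRing R] {p : MvPolynomial (Fin 3) R}
    (h : p * X 2 ∈ Ideal.span ({X 0, X 1} : Set (MvPolynomial (Fin 3) R))) :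
    p ∈ Ideal.span ({X 0, X 1} : Set (MvPolynomial (Fin 3) R)) := by
  have e : ({X 0, X 1} : Set (MvPolynomial (Fin 3) R)) = X '' {0, 1} := by
    rw [Set.image_pair]
  rw [e, mem_ideal_span_X_image] at h ⊢
  intro m hm
  have hm' : m + Finsupp.single 2 1 ∈ (p * X 2).support := by
    rw [mem_support_iff, coeff_mul_X]
    exact mem_support_iff.mp hm
  obtain ⟨i, hi, hne⟩ := h _ hm'
  refine ⟨i, hi, ?_⟩
  rcases hi with rfl | rfl <;> simpa using hne

/-- A saturated ideal of `ℂ[x,y,z]` admits a linear form which is a nonzerodivisor modulo it. -/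
theorem exists_linear_form_regular {I : Ideal S3} (hI : ∀ h, (∀ i, X i * h ∈ I) → h ∈ I) :
    ∃ l : S3, l.IsHomogeneous 1 ∧ ∀ h, l * h ∈ I → h ∈ I := by
  classical
  have hfin : (associatedPrimes S3 (S3 ⧸ I)).Finite := associatedPrimes.finite S3 (S3 ⧸ I)
  let V := homogeneousSubmodule (Fin 3) ℂ 1
  let s : Finset (Subspace ℂ V) := hfin.toFinset.image
    fun P => (P.restrictScalars ℂ).comap V.subtype
  have hs : ⊤ ∉ s := by
    intro htop
    obtain ⟨P, hP, hPtop⟩ := Finset.mem_image.mp htop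
    rw [Set.Finite.mem_toFinset, AssociatedPrimes.mem_iff, isAssociatedPrime_iff] at hP
    obtain ⟨hprime, x, hx⟩ := hP
    obtain ⟨h, rfl⟩ := Ideal.Quotient.mk_surjective x
    have key : ∀ a, a ∈ P ↔ a * h ∈ I := by
      intro a
      rw [hx, Submodule.mem_colon_singleton, Submodule.mem_bot, ← Ideal.Quotient.eq_zero_iff_mem,
        map_mul]
      rfl
    refine hprime.ne_top ((Ideal.eq_top_iff_one P).mpr ((key 1).mpr ?_))
    rw [one_mul]
    refine hI h fun i => (key _).mp ?_
    have : (⟨X i, isHomogeneous_X ℂ i⟩ : V) ∈ (P.restrictScalars ℂ).comap V.subtype := by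
      rw [hPtop]
      trivial
    exact this
  obtain ⟨l, hl⟩ := (Set.ne_univ_iff_exists_notMem _).mp (Subspace.biUnion_ne_univ_of_top_notMem hs)
  refine ⟨l, l.2, fun h hlh => ?_⟩
  have hreg : IsSMulRegular (S3 ⧸ I) (l : S3) := by
    by_contra hcon
    have : (l : S3) ∈ ⋃ p ∈ associatedPrimes S3 (S3 ⧸ I), (p : Set S3) := by
      rw [biUnion_associatedPrimes_eq_compl_regular S3 (S3 ⧸ I)]
      exact hcon
    obtain ⟨P, hP, hlP⟩ := Set.mem_iUnion₂.mp this
    exact hl (Set.mem_iUnion₂.mpr ⟨_, Finset.mem_image_of_mem _ (hfin.mem_toFinset.mpr hP), hlP⟩)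
  rw [← Ideal.Quotient.eq_zero_iff_mem] at hlh ⊢
  refine isSMulRegular_iff_right_eq_zero_of_smul.mp hreg _ ?_
  rw [← hlh, map_mul]
  rfl

/-- Exactness of the Koszul complex of `x, y, z` at the middle spot. -/
theorem koszul_exact {R : Type*} [CommRing R] [IsDomain R] {u v w : MvPolynomial (Fin 3) R}
    (h : X 0 * u + X 1 * v + X 2 * w = 0) :
    ∃ a b c, u = X 1 * c - X 2 * b ∧ v = X 2 * a - X 0 * c ∧ w = X 0 * b - X 1 * a := by
  have hw : w ∈ Ideal.span ({X 0, X 1} : Set (MvPolynomial (Fin 3) R)) := by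
    refine mem_span_X_of_mul_X_mem (Ideal.mem_span_pair.mpr ⟨-u, -v, ?_⟩)
    linear_combination -h
  obtain ⟨b, a, hba⟩ := Ideal.mem_span_pair.mp hw
  have h1 : X 0 * (u + X 2 * b) = X 1 * (-(v + X 2 * a)) := by
    rw [← hba] at h
    linear_combination h
  have h2 : (X 1 : MvPolynomial (Fin 3) R) ∣ u + X 2 * b := by
    refine ((X_prime (i := (1 : Fin 3))).dvd_or_dvd ⟨_, h1⟩).resolve_left ?_
    simp [X_dvd_X]
  obtain ⟨c, hc⟩ := h2
  refine ⟨-a, b, c, ?_, ?_, ?_⟩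
  · linear_combination hc
  · have h3 : X 1 * (X 0 * c) = X 1 * (-(v + X 2 * a)) := by
      rw [← h1, hc]
      ring
    linear_combination mul_left_cancel₀ (X_prime (R := R) (i := (1 : Fin 3))).ne_zero h3
  · linear_combination -hba

/-- The degree `k` piece of an ideal of `ℂ[x,y,z]`. -/
def idealPiece (I : Ideal S3) (k : ℕ) : Submodule ℂ (homogeneousSubmodule (Fin 3) ℂ k) :=
  (I.restrictScalars ℂ).comap (homogeneousSubmodule (Fin 3) ℂ k).subtype

instance finite_homogeneousSubmodule (k : ℕ) :
    Module.Finite ℂ (homogeneousSubmodule (Fin 3) ℂ k) :=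
  Module.Finite.iff_fg.mpr (homogeneousSubmodule_fg (Fin 3) ℂ k)

/-- The pairing with a tuple of forms of degree `n`, on tuples of forms of degree `m`. -/
def formPairing {ι : Type*} [Fintype ι] {n : ℕ} (p : ι → S3) (hp : ∀ i, (p i).IsHomogeneous n)
    (m : ℕ) : (ι → homogeneousSubmodule (Fin 3) ℂ m) →ₗ[ℂ] homogeneousSubmodule (Fin 3) ℂ (m + n) where
  toFun v := ⟨∑ i, (v i : S3) * p i, IsHomogeneous.sum _ _ _ fun i _ => (v i).2.mul (hp i)⟩
  map_add' v w := by
    ext1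
    simp [add_mul, Finset.sum_add_distrib]
  map_smul' c v := by
    ext1
    simp [Finset.smul_sum]

theorem coe_formPairing {ι : Type*} [Fintype ι] {n : ℕ} (p : ι → S3)
    (hp : ∀ i, (p i).IsHomogeneous n) (m : ℕ) (v : ι → homogeneousSubmodule (Fin 3) ℂ m) :
    (formPairing p hp m v : S3) = ∑ i, (v i : S3) * p i :=
  rfl

theorem finrank_range_add_finrank_ker_formPairing {ι : Type*} [Fintype ι] {n : ℕ} (p : ι → S3)
    (hp : ∀ i, (p i).IsHomogeneous n) (m : ℕ) :
    Module.finrank ℂ (formPairing p hp m).range + Module.finrank ℂ (formPairing p hp m).ker =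
      Fintype.card ι * (m + 2).choose 2 := by
  rw [LinearMap.finrank_range_add_finrank_ker, Module.finrank_pi_fintype]
  simp [finrank_homogeneousSubmodule_fin_three]

theorem range_formPairing {ι : Type*} [Fintype ι] {n : ℕ} (p : ι → S3)
    (hp : ∀ i, (p i).IsHomogeneous n) (m : ℕ) :
    (formPairing p hp m).range = idealPiece (Ideal.span (Set.range p)) (m + n) := by
  ext ⟨h, hh⟩
  constructor
  · rintro ⟨v, hv⟩
    have hv' : ∑ i, (v i : S3) * p i = h := congrArg Subtype.val hv
    change h ∈ Ideal.span (Set.range p)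
    exact Ideal.mem_span_range_iff_exists_fun.mpr ⟨fun i => v i, hv'⟩
  · intro hmem
    obtain ⟨c, hc⟩ := Ideal.mem_span_range_iff_exists_fun.mp
      (show h ∈ Ideal.span (Set.range p) from hmem)
    refine ⟨fun i => ⟨homogeneousComponent m (c i), homogeneousComponent_mem m (c i)⟩, ?_⟩
    ext1
    rw [coe_formPairing]
    change _ = h
    rw [← homogeneousComponent_eq_self hh, ← hc, map_sum]
    exact Finset.sum_congr rfl fun i _ => (homogeneousComponent_mul_of_isHomogeneous _ (hp i)).symm

theorem milnorDim_add_eq {f : S3} {n : ℕ} (hp : ∀ i, (pderiv i f).IsHomogeneous n) (m : ℕ) :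
    milnorDim f (m + n) + 3 * (m + 2).choose 2 = (m + n + 2).choose 2 +
      Module.finrank ℂ (formPairing (fun i => pderiv i f) hp m).ker := by
  have h1 := finrank_range_add_finrank_ker_formPairing (fun i => pderiv i f) hp m
  rw [range_formPairing] at h1
  have h2 := (idealPiece (Ideal.span (Set.range fun i => pderiv i f))
    (m + n)).finrank_quotient_add_finrank
  rw [finrank_homogeneousSubmodule_fin_three] at h2
  have h3 : milnorDim f (m + n) = Module.finrank ℂ (homogeneousSubmodule (Fin 3) ℂ (m + n) ⧸
      idealPiece (Ideal.span (Set.range fun i => pderiv i f)) (m + n)) := by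
    have e : jacobianIdeal f = Ideal.span (Set.range fun i => pderiv i f) := by
      rw [jacobianIdeal]
      congr 1
      ext g
      simp [Fin.exists_fin_succ, eq_comm]
    rw [← e]
    rfl
  rw [Fintype.card_fin] at h1
  omega

/-- The Hilbert function of a complete intersection bounds that of any ideal containing it. -/
theorem two_mul_choose_le_finrank_idealPiece {I : Ideal S3} {r : ℕ} {g : Fin 2 → S3}
    (hg : ∀ i, (g i).IsHomogeneous r) (hgI : ∀ i, g i ∈ I) (hg0 : g ≠ 0)
    (hprim : ∀ p, Prime p → ¬ ∀ i, p ∣ g i) (N : ℕ) :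
    2 * (N + r + 2).choose 2 ≤
      Module.finrank ℂ (idealPiece I (N + r + r)) + (N + 2).choose 2 := by
  have h1 := finrank_range_add_finrank_ker_formPairing g hg (N + r)
  have h2 : Module.finrank ℂ (formPairing g hg (N + r)).range ≤
      Module.finrank ℂ (idealPiece I (N + r + r)) := by
    rw [range_formPairing]
    refine Submodule.finrank_mono (Submodule.comap_mono ?_)
    refine fun x hx => Ideal.span_le.mpr ?_ hx
    rintro _ ⟨i, rfl⟩
    exact hgI i
  have h3 : Module.finrank ℂ (formPairing g hg (N + r)).ker ≤ (N + 2).choose 2 := by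
    let A : homogeneousSubmodule (Fin 3) ℂ N →ₗ[ℂ]
        (Fin 2 → homogeneousSubmodule (Fin 3) ℂ (N + r)) :=
      { toFun := fun t => ![⟨-(t * g 1), (t.2.mul (hg 1)).neg⟩, ⟨t * g 0, t.2.mul (hg 0)⟩]
        map_add' := fun a b => by
          ext i : 2
          fin_cases i <;> simp <;> ring
        map_smul' := fun c a => by
          ext i : 2
          fin_cases i <;> simp }
    have hA : (formPairing g hg (N + r)).ker ≤ A.range := by
      intro v hv
      have hv' : (v 0 : S3) * g 0 + v 1 * g 1 = 0 := by
        have := congrArg Subtype.val (LinearMap.mem_ker.mp hv)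
        rwa [coe_formPairing, Fin.sum_univ_two] at this
      obtain ⟨c, hc⟩ := exists_eq_mul_of_cross_eq (a := g) (b := ![(v 1 : S3), -(v 0 : S3)]) hg0
        hprim (by
          simp only [Fin.forall_fin_two, Matrix.cons_val_zero, Matrix.cons_val_one, true_and,
            and_true]
          exact ⟨by linear_combination -hv', by linear_combination hv'⟩)
      have hc0 : (v 1 : S3) = c * g 0 := hc 0
      have hc1 : -(v 0 : S3) = c * g 1 := hc 1
      refine ⟨⟨homogeneousComponent N c, homogeneousComponent_mem N c⟩, ?_⟩
      ext i : 2
      fin_cases i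
      · change -(homogeneousComponent N c * g 1) = (v 0 : S3)
        rw [← homogeneousComponent_mul_of_isHomogeneous _ (hg 1), ← hc1, map_neg, neg_neg,
          homogeneousComponent_eq_self (v 0).2]
      · change homogeneousComponent N c * g 0 = (v 1 : S3)
        rw [← homogeneousComponent_mul_of_isHomogeneous _ (hg 0), ← hc0,
          homogeneousComponent_eq_self (v 1).2]
    calc _ ≤ Module.finrank ℂ A.range := Submodule.finrank_mono hA
      _ ≤ _ := LinearMap.finrank_range_le A
      _ = _ := finrank_homogeneousSubmodule_fin_three N
  rw [Fintype.card_fin] at h1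
  omega

/-- The Hilbert function of the quotient by a saturated ideal is nondecreasing. -/
theorem choose_add_finrank_idealPiece_le {I : Ideal S3}
    (hI : ∀ h, (∀ i, X i * h ∈ I) → h ∈ I) (k j : ℕ) :
    (k + 2).choose 2 + Module.finrank ℂ (idealPiece I (k + j)) ≤
      (k + j + 2).choose 2 + Module.finrank ℂ (idealPiece I k) := by
  obtain ⟨l, hl, hreg⟩ := exists_linear_form_regular hI
  induction j with
  | zero => exact le_refl _
  | succ j ih =>
    let A : homogeneousSubmodule (Fin 3) ℂ (k + j) →ₗ[ℂ]
        (homogeneousSubmodule (Fin 3) ℂ (k + j + 1) ⧸ idealPiece I (k + j + 1)) :=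
      (idealPiece I (k + j + 1)).mkQ ∘ₗ formPairing (fun _ : Unit => l) (fun _ => hl) (k + j) ∘ₗ
        LinearMap.pi fun _ => LinearMap.id
    have hker : A.ker ≤ idealPiece I (k + j) := by
      intro v hv
      have h1 : formPairing (fun _ : Unit => l) (fun _ => hl) (k + j) (fun _ => v) ∈
          idealPiece I (k + j + 1) := (Submodule.Quotient.mk_eq_zero _).mp hv
      have h2 : ∑ _i : Unit, (v : S3) * l ∈ I := h1
      rw [Fintype.sum_unique, mul_comm] at h2
      exact hreg _ h2
    have h1 := A.finrank_range_add_finrank_ker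
    have h2 := Submodule.finrank_mono hker
    have h3 := Submodule.finrank_le A.range
    have h4 := (idealPiece I (k + j + 1)).finrank_quotient_add_finrank
    rw [finrank_homogeneousSubmodule_fin_three] at h1 h4
    rw [← add_assoc]
    omega

open Matrix in
/-- The ideal of the `h` for which `h ∇f` is the cross product of `ρ` and a Jacobian syzygy. -/
def bourbakiIdeal (f : S3) (ρ : Fin 3 → S3) : Ideal S3 where
  carrier := {h | ∃ σ ∈ jacSyz f, ρ ⨯₃ σ = h • fun i => pderiv i f}
  add_mem' := by
    rintro a b ⟨σ, hσ, h1⟩ ⟨σ', hσ', h2⟩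
    exact ⟨σ + σ', add_mem hσ hσ', by rw [map_add, h1, h2, add_smul]⟩
  zero_mem' := ⟨0, zero_mem _, by simp⟩
  smul_mem' := by
    rintro c a ⟨σ, hσ, h1⟩
    exact ⟨c • σ, Submodule.smul_mem _ c hσ, by rw [map_smul, h1, smul_smul, smul_eq_mul]⟩

open Matrix in
theorem mem_bourbakiIdeal {f : S3} {ρ : Fin 3 → S3} {h : S3} :
    h ∈ bourbakiIdeal f ρ ↔ ∃ σ ∈ jacSyz f, ρ ⨯₃ σ = h • fun i => pderiv i f :=
  Iff.rfl

theorem mem_jacSyz {f : S3} {v : Fin 3 → S3} :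
    v ∈ jacSyz f ↔ v 0 * pderiv 0 f + v 1 * pderiv 1 f + v 2 * pderiv 2 f = 0 :=
  Iff.rfl

theorem homogeneousComponent_mem_jacSyz {f : S3} {n : ℕ}
    (hf : ∀ i, (pderiv i f).IsHomogeneous n) {σ : Fin 3 → S3} (hσ : σ ∈ jacSyz f) (m : ℕ) :
    (fun i => homogeneousComponent m (σ i)) ∈ jacSyz f := by
  rw [mem_jacSyz] at hσ ⊢
  have := congrArg (homogeneousComponent (m + n)) hσ
  simpa only [map_add, homogeneousComponent_mul_of_isHomogeneous _ (hf _), map_zero] using this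

open Matrix in
theorem cross_homogeneousComponent {r : ℕ} {ρ : Fin 3 → S3} (hρ : ∀ i, (ρ i).IsHomogeneous r)
    (σ : Fin 3 → S3) (m : ℕ) :
    (ρ ⨯₃ fun i => homogeneousComponent m (σ i)) =
      fun i => homogeneousComponent (m + r) ((ρ ⨯₃ σ) i) := by
  ext1 i
  have key : ∀ i j, homogeneousComponent (m + r) (ρ i * σ j) =
      ρ i * homogeneousComponent m (σ j) := by
    intro i j
    rw [mul_comm, homogeneousComponent_mul_of_isHomogeneous _ (hρ i), mul_comm]
  fin_cases i <;> simp [cross_apply, key]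

theorem forall_mul_comm_of_fin_three {R : Type*} [Mul R] {a b : Fin 3 → R}
    (h01 : a 0 * b 1 = a 1 * b 0) (h02 : a 0 * b 2 = a 2 * b 0) (h12 : a 1 * b 2 = a 2 * b 1)
    (i j : Fin 3) : a i * b j = a j * b i := by
  fin_cases i <;> fin_cases j
  exacts [rfl, h01, h02, h01.symm, rfl, h12, h02.symm, h12.symm, rfl]

open Matrix in
theorem exists_cross_eq_smul {f : S3} (hf0 : (fun i => pderiv i f) ≠ 0)
    (hf : ∀ p, Prime p → ¬ ∀ i, p ∣ pderiv i f) {ρ σ : Fin 3 → S3} (hρ : ρ ∈ jacSyz f)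
    (hσ : σ ∈ jacSyz f) : ∃ h : S3, ρ ⨯₃ σ = h • fun i => pderiv i f := by
  rw [mem_jacSyz] at hρ hσ
  obtain ⟨c, hc⟩ := exists_eq_mul_of_cross_eq (b := ρ ⨯₃ σ) hf0 hf (by
    have h01 : pderiv 0 f * (ρ ⨯₃ σ) 1 = pderiv 1 f * (ρ ⨯₃ σ) 0 := by
      simp only [cross_apply, cons_val_zero, cons_val_one]
      linear_combination ρ 2 * hσ - σ 2 * hρ
    have h02 : pderiv 0 f * (ρ ⨯₃ σ) 2 = pderiv 2 f * (ρ ⨯₃ σ) 0 := by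
      simp only [cross_apply, cons_val_zero, cons_val]
      linear_combination σ 1 * hρ - ρ 1 * hσ
    have h12 : pderiv 1 f * (ρ ⨯₃ σ) 2 = pderiv 2 f * (ρ ⨯₃ σ) 1 := by
      simp only [cross_apply, cons_val_one, cons_val]
      linear_combination ρ 0 * hσ - σ 0 * hρ
    exact forall_mul_comm_of_fin_three h01 h02 h12)
  exact ⟨c, funext hc⟩

open Matrix in
theorem exists_eq_smul_of_cross_eq_zero {ρ σ : Fin 3 → S3} (hρ0 : ρ ≠ 0)
    (hρ : ∀ p, Prime p → ¬ ∀ i, p ∣ ρ i) (h : ρ ⨯₃ σ = 0) : ∃ c : S3, σ = c • ρ := by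
  obtain ⟨c, hc⟩ := exists_eq_mul_of_cross_eq (b := σ) hρ0 hρ (by
    have h0 := congrFun h 0
    have h1 := congrFun h 1
    have h2 := congrFun h 2
    simp only [cross_apply, cons_val_zero, cons_val_one, cons_val, Pi.zero_apply] at h0 h1 h2
    exact forall_mul_comm_of_fin_three (by linear_combination h2) (by linear_combination -h1)
      (by linear_combination h0))
  exact ⟨c, funext hc⟩

open Matrix in
/-- The entries of a syzygy `ρ` lie in its Bourbaki ideal, because of the Koszul syzygies. -/
theorem apply_mem_bourbakiIdeal {f : S3} {ρ : Fin 3 → S3} (hρ : ρ ∈ jacSyz f) (i : Fin 3) :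
    ρ i ∈ bourbakiIdeal f ρ := by
  rw [mem_jacSyz] at hρ
  refine mem_bourbakiIdeal.mpr ⟨(fun i => pderiv i f) ⨯₃ Pi.single i 1, ?_, ?_⟩
  · rw [mem_jacSyz]
    fin_cases i <;> simp [cross_apply] <;> ring
  · ext1 j
    fin_cases i <;> fin_cases j <;> simp [cross_apply] <;> linear_combination -hρ

/-- A syzygy of minimal degree is primitive. -/
theorem not_forall_dvd_of_isMDR {f : S3} {n r : ℕ} (hf : ∀ i, (pderiv i f).IsHomogeneous n)
    (hmin : ∀ m, m < r → ∀ v ∈ jacSyz f, (∀ i, (v i).IsHomogeneous m) → v = 0)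
    {ρ : Fin 3 → S3} (hρ : ρ ∈ jacSyz f) (hρ0 : ρ ≠ 0) (hρr : ∀ i, (ρ i).IsHomogeneous r)
    (p : S3) (hp : Prime p) : ¬ ∀ i, p ∣ ρ i := by
  intro h
  choose σ hσ using h
  have hσmem : σ ∈ jacSyz f := by
    rw [mem_jacSyz] at hρ ⊢
    refine mul_left_cancel₀ hp.ne_zero ?_
    rw [hσ 0, hσ 1, hσ 2] at hρ
    linear_combination hρ
  have hpdeg : p.totalDegree ≠ 0 := by
    intro h0
    have hC := totalDegree_eq_zero_iff_eq_C.mp h0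
    refine hp.not_isUnit ?_
    rw [hC]
    refine (isUnit_iff_ne_zero.mpr fun h1 => hp.ne_zero ?_).map C
    rw [hC, h1, C_0]
  refine hρ0 (funext fun i => ?_)
  rw [hσ i, Pi.zero_apply]
  refine mul_eq_zero_of_right _ ?_
  by_contra hne
  have hdeg : p.totalDegree + (σ i).totalDegree = r := by
    rw [← totalDegree_mul_of_isDomain hp.ne_zero hne, ← hσ i]
    exact (hρr i).totalDegree (by rw [hσ i]; exact mul_ne_zero hp.ne_zero hne)
  refine hne ?_
  rw [← sum_homogeneousComponent (σ i)]
  refine Finset.sum_eq_zero fun m hm => ?_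
  rw [Finset.mem_range] at hm
  exact congrFun (hmin m (by omega) _ (homogeneousComponent_mem_jacSyz hf hσmem m)
    fun i => homogeneousComponent_isHomogeneous m (σ i)) i

open Matrix in
theorem bourbakiIdeal_saturated {f : S3} {ρ : Fin 3 → S3} (hρ : ρ ∈ jacSyz f) (hρ0 : ρ ≠ 0)
    (hprim : ∀ p, Prime p → ¬ ∀ i, p ∣ ρ i) (h : S3) (hh : ∀ i, X i * h ∈ bourbakiIdeal f ρ) :
    h ∈ bourbakiIdeal f ρ := by
  choose σ hσ hcross using fun i => mem_bourbakiIdeal.mp (hh i)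
  have key : ∀ i j, ∃ c : S3, (X i : S3) • σ j - (X j : S3) • σ i = c • ρ := by
    intro i j
    refine exists_eq_smul_of_cross_eq_zero hρ0 hprim ?_
    rw [map_sub, map_smul, map_smul, hcross, hcross, smul_smul, smul_smul, ← sub_smul]
    convert zero_smul S3 _
    ring
  obtain ⟨u, hu⟩ := key 1 2
  obtain ⟨v, hv⟩ := key 2 0
  obtain ⟨w, hw⟩ := key 0 1
  have hkos : X 0 * u + X 1 * v + X 2 * w = 0 := by
    have h0 : (X 0 * u + X 1 * v + X 2 * w) • ρ = 0 := by
      ext1 j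
      have hu := congrFun hu j
      have hv := congrFun hv j
      have hw := congrFun hw j
      simp only [Pi.sub_apply, Pi.smul_apply, smul_eq_mul, Pi.zero_apply] at hu hv hw ⊢
      linear_combination -X 0 * hu - X 1 * hv - X 2 * hw
    exact (smul_eq_zero.mp h0).resolve_right hρ0
  obtain ⟨a, b, c, -, -, hwab⟩ := koszul_exact hkos
  have hdvd : ∀ j, (X 0 : S3) ∣ (σ 0 - a • ρ) j := by
    intro j
    have h1 : (X 1 : S3) * (σ 0 - a • ρ) j = X 0 * (σ 1 - b • ρ) j := by
      have := congrFun hw j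
      simp only [Pi.sub_apply, Pi.smul_apply, smul_eq_mul] at this ⊢
      rw [hwab] at this
      linear_combination -this
    refine ((X_prime (i := (0 : Fin 3))).dvd_or_dvd ⟨_, h1⟩).resolve_left ?_
    simp [X_dvd_X]
  choose s hs using hdvd
  have hs' : (X 0 : S3) • s = σ 0 - a • ρ := funext fun j => (hs j).symm
  have hX : (X 0 : S3) ≠ 0 := (X_prime (i := (0 : Fin 3))).ne_zero
  refine mem_bourbakiIdeal.mpr ⟨s, ?_, ?_⟩
  · have hmem : (X 0 : S3) • s ∈ jacSyz f := by
      rw [hs']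
      exact sub_mem (hσ 0) (Submodule.smul_mem _ _ hρ)
    rw [mem_jacSyz] at hmem ⊢
    simp only [Pi.smul_apply, smul_eq_mul] at hmem
    refine mul_left_cancel₀ hX ?_
    linear_combination hmem
  · refine smul_right_injective _ hX ?_
    change (X 0 : S3) • (ρ ⨯₃ s) = (X 0 : S3) • (h • fun i => pderiv i f)
    rw [← map_smul, hs', map_sub, map_smul, cross_self, smul_zero, sub_zero, hcross, mul_smul]

theorem finrank_eq_add_of_ker_eq_range {K U V W : Type*} [Field K] [AddCommGroup U] [Module K U]
    [AddCommGroup V] [Module K V] [FiniteDimensional K V] [AddCommGroup W] [Module K W]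
    (g : U →ₗ[K] V) (h : V →ₗ[K] W) (hg : Function.Injective g) (hgh : h.ker = g.range) :
    Module.finrank K V = Module.finrank K U + Module.finrank K h.range := by
  rw [← h.finrank_range_add_finrank_ker, hgh, LinearMap.finrank_range_of_inj hg, add_comm]

open Matrix in
/-- The exact sequence `0 → S(-r) → D_0(f) → I(r - n) → 0` in a single degree, `I` being the
Bourbaki ideal of a primitive syzygy of degree `r`; the degree piece of `D_0(f)` is given as
the image of an injective linear map `ι`. -/
theorem finrank_eq_choose_add_of_range_eq {V : Type*} [AddCommGroup V] [Module ℂ V]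
    [Module.Finite ℂ V] {f : S3} {n r : ℕ}
    (hfn : ∀ i, (pderiv i f).IsHomogeneous n) (hf0 : (fun i => pderiv i f) ≠ 0)
    (hf : ∀ p, Prime p → ¬ ∀ i, p ∣ pderiv i f)
    {ρ : Fin 3 → S3} (hρ : ρ ∈ jacSyz f) (hρ0 : ρ ≠ 0) (hρr : ∀ i, (ρ i).IsHomogeneous r)
    (hprim : ∀ p, Prime p → ¬ ∀ i, p ∣ ρ i) (N : ℕ) (ι : V →ₗ[ℂ] (Fin 3 → S3))
    (ι_inj : Function.Injective ι) (ι_hom : ∀ σ i, (ι σ i).IsHomogeneous (N + n + r))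
    (ι_mem : ∀ σ, ι σ ∈ jacSyz f)
    (ι_surj : ∀ σ ∈ jacSyz f, (∀ i, (σ i).IsHomogeneous (N + n + r)) → ∃ s, ι s = σ) :
    Module.finrank ℂ V =
      (N + n + 2).choose 2 + Module.finrank ℂ (idealPiece (bourbakiIdeal f ρ) (N + r + r)) := by
  have hcomp : ∀ h : S3, (fun i => homogeneousComponent (N + n + r + r)
      ((h • fun i => pderiv i f) i)) = homogeneousComponent (N + r + r) h • fun i => pderiv i f := by
    intro h
    ext1 i
    simp only [Pi.smul_apply, smul_eq_mul]
    rw [show N + n + r + r = N + r + r + n by ring,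
      homogeneousComponent_mul_of_isHomogeneous _ (hfn i)]
  have hex : ∀ σ : V, ∃ h : homogeneousSubmodule (Fin 3) ℂ (N + r + r),
      ρ ⨯₃ ι σ = (h : S3) • fun i => pderiv i f := by
    intro σ
    obtain ⟨h, hh⟩ := exists_cross_eq_smul hf0 hf hρ (ι_mem σ)
    refine ⟨⟨homogeneousComponent (N + r + r) h, homogeneousComponent_mem _ h⟩, ?_⟩
    change _ = homogeneousComponent (N + r + r) h • fun i => pderiv i f
    rw [← hcomp, ← hh, ← cross_homogeneousComponent hρr]
    congr 1
    exact funext fun i => (homogeneousComponent_eq_self (ι_hom σ i)).symm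
  choose φ hφ using hex
  have hinj : ∀ a b : S3, (a • fun i => pderiv i f) = b • (fun i => pderiv i f) → a = b :=
    fun a b hab => smul_left_injective S3 hf0 hab
  let Φ : V →ₗ[ℂ] homogeneousSubmodule (Fin 3) ℂ (N + r + r) :=
    { toFun := φ
      map_add' := fun a b => Subtype.ext <| hinj _ _ <| by
        rw [← hφ, map_add, map_add, hφ, hφ, Submodule.coe_add, add_smul]
      map_smul' := fun c a => Subtype.ext <| hinj _ _ <| by
        rw [← hφ, map_smul, LinearMap.map_smul_of_tower, hφ]
        simp [smul_assoc] }
  have hrange : Φ.range = idealPiece (bourbakiIdeal f ρ) (N + r + r) := by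
    ext h
    constructor
    · rintro ⟨σ, rfl⟩
      exact ⟨ι σ, ι_mem σ, hφ σ⟩
    · rintro ⟨σ, hσ, hh⟩
      obtain ⟨s, hs⟩ := ι_surj _ (homogeneousComponent_mem_jacSyz hfn hσ (N + n + r))
        fun i => homogeneousComponent_isHomogeneous _ _
      refine ⟨s, Subtype.ext (hinj _ _ ?_)⟩
      change (φ s : S3) • _ = _
      rw [← hφ, hs, cross_homogeneousComponent hρr, hh, hcomp]
      congr 1
      exact homogeneousComponent_eq_self h.2
  have hmul : ∀ c : homogeneousSubmodule (Fin 3) ℂ (N + n), ∃ s : V, ι s = (c : S3) • ρ :=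
    fun c => ι_surj _ (Submodule.smul_mem _ _ hρ) fun i => c.2.mul (hρr i)
  choose ψ hψ using hmul
  let Ψ : homogeneousSubmodule (Fin 3) ℂ (N + n) →ₗ[ℂ] V :=
    { toFun := ψ
      map_add' := fun a b => ι_inj <| by
        rw [map_add, hψ, hψ, hψ, Submodule.coe_add, add_smul]
      map_smul' := fun c a => ι_inj <| by
        rw [RingHom.id_apply, map_smul, hψ, hψ, Submodule.coe_smul, smul_assoc] }
  have hΨinj : Function.Injective Ψ := by
    intro a b hab
    have h1 : ι (ψ a) = ι (ψ b) := congrArg ι hab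
    rw [hψ, hψ] at h1
    exact Subtype.ext (smul_left_injective S3 hρ0 h1)
  have hker : Φ.ker = Ψ.range := by
    ext σ
    rw [LinearMap.mem_ker]
    constructor
    · intro h0
      have h1 := hφ σ
      rw [show φ σ = 0 from h0, Submodule.coe_zero, zero_smul] at h1
      obtain ⟨c, hc⟩ := exists_eq_smul_of_cross_eq_zero hρ0 hprim h1
      refine ⟨⟨homogeneousComponent (N + n) c, homogeneousComponent_mem _ c⟩, ι_inj ?_⟩
      change ι (ψ _) = _
      rw [hψ]
      ext1 i
      change homogeneousComponent (N + n) c * ρ i = _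
      rw [← homogeneousComponent_mul_of_isHomogeneous _ (hρr i),
        ← homogeneousComponent_eq_self (ι_hom σ i), hc]
      rfl
    · rintro ⟨c, rfl⟩
      refine Subtype.ext (hinj _ _ ?_)
      change (φ (ψ c) : S3) • _ = _
      rw [← hφ, hψ, map_smul, cross_self, smul_zero, Submodule.coe_zero, zero_smul]
  rw [← hrange, ← finrank_homogeneousSubmodule_fin_three]
  exact finrank_eq_add_of_ker_eq_range (U := homogeneousSubmodule (Fin 3) ℂ (N + n)) (V := V)
    (W := homogeneousSubmodule (Fin 3) ℂ (N + r + r)) Ψ Φ hΨinj hker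

theorem finrank_ker_formPairing_pderiv {f : S3} {n r : ℕ}
    (hfn : ∀ i, (pderiv i f).IsHomogeneous n) (hf0 : (fun i => pderiv i f) ≠ 0)
    (hf : ∀ p, Prime p → ¬ ∀ i, p ∣ pderiv i f)
    {ρ : Fin 3 → S3} (hρ : ρ ∈ jacSyz f) (hρ0 : ρ ≠ 0) (hρr : ∀ i, (ρ i).IsHomogeneous r)
    (hprim : ∀ p, Prime p → ¬ ∀ i, p ∣ ρ i) (N : ℕ) :
    Module.finrank ℂ (formPairing (fun i => pderiv i f) hfn (N + n + r)).ker =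
      (N + n + 2).choose 2 + Module.finrank ℂ (idealPiece (bourbakiIdeal f ρ) (N + r + r)) := by
  refine finrank_eq_choose_add_of_range_eq
    (V := (formPairing (fun i => pderiv i f) hfn (N + n + r)).ker) hfn hf0 hf hρ hρ0 hρr hprim N
    ((LinearMap.pi fun i => (homogeneousSubmodule (Fin 3) ℂ (N + n + r)).subtype ∘ₗ
      LinearMap.proj i) ∘ₗ
        (formPairing (fun i => pderiv i f) hfn (N + n + r)).ker.subtype)
    (fun a b hab => Subtype.ext (funext fun i => Subtype.ext (congrFun hab i)))
    (fun σ i => (σ.1 i).2) (fun σ => ?_) (fun σ hσ hhom => ?_)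
  · have h1 := congrArg Subtype.val (LinearMap.mem_ker.mp σ.2)
    rw [coe_formPairing, Fin.sum_univ_three] at h1
    exact h1
  · refine ⟨⟨fun i => ⟨σ i, hhom i⟩, ?_⟩, rfl⟩
    refine LinearMap.mem_ker.mpr (Subtype.ext ?_)
    rw [coe_formPairing, Fin.sum_univ_three]
    exact hσ

open Matrix in
theorem idealPiece_bourbakiIdeal_eq_bot {f : S3} {n r k : ℕ}
    (hfn : ∀ i, (pderiv i f).IsHomogeneous n) (hf0 : (fun i => pderiv i f) ≠ 0)
    (hmin : ∀ m, m < r → ∀ v ∈ jacSyz f, (∀ i, (v i).IsHomogeneous m) → v = 0)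
    {ρ : Fin 3 → S3} (hρr : ∀ i, (ρ i).IsHomogeneous r) (hr : 0 < r) (hk : k + n + 1 = r + r) :
    idealPiece (bourbakiIdeal f ρ) k = ⊥ := by
  rw [eq_bot_iff]
  rintro h ⟨σ, hσ, hh⟩
  have h0 := hmin (r - 1) (by omega) _ (homogeneousComponent_mem_jacSyz hfn hσ (r - 1))
    fun i => homogeneousComponent_isHomogeneous _ _
  have h1 := cross_homogeneousComponent hρr σ (r - 1)
  rw [h0, map_zero, hh] at h1
  refine (Submodule.mem_bot ℂ).mpr (Subtype.ext ?_)
  refine smul_left_injective S3 hf0 ?_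
  change (h : S3) • (fun i => pderiv i f) = (0 : S3) • _
  rw [zero_smul, h1]
  ext1 i
  change _ = homogeneousComponent (r - 1 + r) ((h : S3) * pderiv i f)
  rw [show r - 1 + r = k + n by omega, homogeneousComponent_eq_self (h.2.mul (hfn i))]
  rfl

theorem two_mul_choose_two_eq (k : ℕ) : 2 * ((k + 2).choose 2 : ℤ) = ((k : ℤ) + 2) * (k + 1) := by
  have h : (k + 2).choose 2 * 2 = (k + 2) * (k + 1) := by
    rw [Nat.choose_two_right]
    exact Nat.div_mul_cancel (Nat.even_mul_pred_self (k + 2)).two_dvd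
  exact_mod_cast (by rw [mul_comm]; exact h : 2 * (k + 2).choose 2 = (k + 2) * (k + 1))

/-- du Plessis–Wall bounds on the total Tjurina number of a reduced plane curve
`C : f = 0` of degree `d ≥ 3`, not the union of `d` lines through one point,
where `r = mdr(f)`. -/
theorem statement0 (f : S3) (d r τ : ℕ) (hd : 3 ≤ d)
    (hhom : f.IsHomogeneous d) (hred : Squarefree f)
    (hlines : ¬ IsUnionOfConcurrentLines f d)
    (hmdr : IsMDR f r) (htau : IsTjurina f τ) :
    (((d : ℤ) - 1) * ((d : ℤ) - r - 1) ≤ (τ : ℤ) ∧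
      (τ : ℤ) ≤ ((d : ℤ) - 1) ^ 2 - r * ((d : ℤ) - r - 1)) ∧
    (d ≤ 2 * r →
      (τ : ℤ) ≤ ((d : ℤ) - 1) ^ 2 - r * ((d : ℤ) - r - 1) -
        (Nat.choose (2 * r + 2 - d) 2 : ℤ)) := by
  obtain ⟨n, rfl⟩ : ∃ n, d = n + 1 := ⟨d - 1, by omega⟩
  obtain ⟨⟨ρ, hρ, hρ0, hρr⟩, hmin⟩ := hmdr
  have hfn : ∀ i, (pderiv i f).IsHomogeneous n := fun i => hhom.pderiv
  have hf := not_forall_dvd_pderiv (Nat.succ_ne_zero n) hhom hred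
  have hf0 : (fun i => pderiv i f) ≠ 0 := fun h0 =>
    hf (X 0) X_prime fun i => (congrFun h0 i : pderiv i f = 0) ▸ dvd_zero _
  have hprim := not_forall_dvd_of_isMDR hfn hmin hρ hρ0 hρr
  obtain ⟨K, hK⟩ := Filter.eventually_atTop.mp htau
  have hτ := milnorDim_add_eq hfn (K + n + r)
  rw [hK _ (by omega), finrank_ker_formPairing_pderiv hfn hf0 hf hρ hρ0 hρr hprim] at hτ
  have hup := Submodule.finrank_le (idealPiece (bourbakiIdeal f ρ) (K + r + r))
  rw [finrank_homogeneousSubmodule_fin_three] at hup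
  have hlow : 2 * (K + r + 2).choose 2 ≤ Module.finrank ℂ
      (idealPiece (bourbakiIdeal f ρ) (K + r + r)) + (K + 2).choose 2 := by
    obtain ⟨s, t, hs0, hst⟩ := exists_coprime_combinations (K := ℂ) ρ hprim hρ0
    have hcomb : ∀ s : Fin 3 → ℂ, (∑ i, s i • ρ i).IsHomogeneous r ∧
        ∑ i, s i • ρ i ∈ bourbakiIdeal f ρ := fun s =>
      ⟨IsHomogeneous.sum _ _ _ fun i _ =>
          (homogeneousSubmodule (Fin 3) ℂ r).smul_mem (s i) (hρr i),
        Ideal.sum_mem _ fun i _ => Submodule.smul_of_tower_mem _ (s i)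
          (apply_mem_bourbakiIdeal hρ i)⟩
    refine two_mul_choose_le_finrank_idealPiece (g := ![∑ i, s i • ρ i, ∑ i, t i • ρ i])
      (Fin.forall_fin_two.mpr ⟨(hcomb s).1, (hcomb t).1⟩)
      (Fin.forall_fin_two.mpr ⟨(hcomb s).2, (hcomb t).2⟩)
      (fun h0 => hs0 (congrFun h0 0)) (fun p hp hdvd => hst p hp (hdvd 0) (hdvd 1)) K
  have e1 := two_mul_choose_two_eq (K + n + r)
  have e2 := two_mul_choose_two_eq (K + n + r + n)
  have e3 := two_mul_choose_two_eq (K + n)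
  have e4 := two_mul_choose_two_eq (K + r + r)
  have e5 := two_mul_choose_two_eq (K + r)
  have e6 := two_mul_choose_two_eq K
  zify at hτ hup hlow
  push_cast at *
  refine ⟨⟨?_, ?_⟩, fun hdr => ?_⟩
  · linarith
  · linarith
  · obtain ⟨k, hk⟩ : ∃ k, k + n + 1 = r + r := ⟨r + r - (n + 1), by omega⟩
    have hsat := choose_add_finrank_idealPiece_le (bourbakiIdeal_saturated hρ hρ0 hprim) k
      (K + n + 1)
    rw [idealPiece_bourbakiIdeal_eq_bot hfn hf0 hmin hρr (by omega) hk, finrank_bot, add_zero,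
      show k + (K + n + 1) = K + r + r by omega] at hsat
    rw [show 2 * r + 1 - n = k + 2 by omega]
    zify at hsat
    linarith

end
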